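/- Let n ≥ 2 be an integer, let Ω ⊆ ℝⁿ be an open set, and let f : Ω → ℝ be a C² function with f(x) > 0 for all x ∈ Ω and −Δf(x) ≥ c f(x) for all x ∈ Ω, for some constant c ∈ ℝ. Then λ*(Ω) ≥ c. -/

import Mathlib

open scoped ENNReal Topology
open MeasureTheory

/-- The fundamental tone `λ*(Ω)` of an open set `Ω ⊆ ℝⁿ`: the infimum of the Rayleigh
quotients `∫_Ω ‖∇φ‖² / ∫_Ω φ²` over all smooth functions `φ : ℝⁿ → ℝ`, not identically
zero, with compact support contained in `Ω` (valued in `ℝ≥0∞`; it is `∞` if no such `φ`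
exists). -/
noncomputable def lamStar (n : ℕ) (Ω : Set (EuclideanSpace ℝ (Fin n))) : ℝ≥0∞ :=
  ⨅ φ : {φ : EuclideanSpace ℝ (Fin n) → ℝ //
      ContDiff ℝ (⊤ : ℕ∞) φ ∧ HasCompactSupport φ ∧ tsupport φ ⊆ Ω ∧ φ ≠ 0},
    ENNReal.ofReal ((∫ x in Ω, ‖gradient φ.1 x‖ ^ 2) / ∫ x in Ω, φ.1 x ^ 2)

/-- The divergence of a vector field `X : ℝⁿ → ℝⁿ` at `x`: the trace of its derivative. -/
noncomputable def ediv {n : ℕ} (X : EuclideanSpace ℝ (Fin n) → EuclideanSpace ℝ (Fin n))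
    (x : EuclideanSpace ℝ (Fin n)) : ℝ :=
  LinearMap.trace ℝ _ (fderiv ℝ X x).toLinearMap

/-- The Laplacian of `f : ℝⁿ → ℝ` at `x`: the trace of its Hessian, i.e. the divergence
of its gradient. -/
noncomputable def lap {n : ℕ} (f : EuclideanSpace ℝ (Fin n) → ℝ)
    (x : EuclideanSpace ℝ (Fin n)) : ℝ :=
  LinearMap.trace ℝ _ (fderiv ℝ (gradient f) x).toLinearMap

theorem ediv_eq_sum_inner {n : ℕ} (X : EuclideanSpace ℝ (Fin n) → EuclideanSpace ℝ (Fin n))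
    (x : EuclideanSpace ℝ (Fin n)) :
    ediv X x = ∑ i, inner ℝ (EuclideanSpace.basisFun (Fin n) ℝ i)
      (fderiv ℝ X x (EuclideanSpace.basisFun (Fin n) ℝ i)) :=
  LinearMap.trace_eq_sum_inner _ (EuclideanSpace.basisFun (Fin n) ℝ)

theorem ContDiff.continuous_ediv {n : ℕ}
    {X : EuclideanSpace ℝ (Fin n) → EuclideanSpace ℝ (Fin n)} (hX : ContDiff ℝ 1 X) :
    Continuous (ediv X) := by
  have h := hX.continuous_fderiv one_ne_zero
  rw [funext (ediv_eq_sum_inner X)]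
  fun_prop

theorem ediv_eq_zero_of_notMem_tsupport {n : ℕ}
    {X : EuclideanSpace ℝ (Fin n) → EuclideanSpace ℝ (Fin n)} {x : EuclideanSpace ℝ (Fin n)}
    (hx : x ∉ tsupport X) : ediv X x = 0 := by
  have h : fderiv ℝ X x = 0 :=
    image_eq_zero_of_notMem_tsupport fun h => hx (tsupport_fderiv_subset ℝ h)
  rw [ediv, h, ContinuousLinearMap.toLinearMap_zero, map_zero]

theorem gradient_eq_zero_of_notMem_tsupport {E : Type*} [NormedAddCommGroup E]
    [InnerProductSpace ℝ E] [CompleteSpace E] {φ : E → ℝ} {x : E} (hx : x ∉ tsupport φ) :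
    gradient φ x = 0 := by
  have h : fderiv ℝ φ x = 0 :=
    image_eq_zero_of_notMem_tsupport fun h => hx (tsupport_fderiv_subset ℝ h)
  rw [gradient, h, map_zero]

/-- The divergence theorem for compactly supported `C¹` vector fields. -/
theorem integral_ediv_eq_zero {n : ℕ}
    {X : EuclideanSpace ℝ (Fin n) → EuclideanSpace ℝ (Fin n)} (hX : ContDiff ℝ 1 X)
    (hXc : HasCompactSupport X) : ∫ x, ediv X x = 0 := by
  have hint (v : EuclideanSpace ℝ (Fin n)) : Integrable (fun x => fderiv ℝ X x v) :=
    ((hX.continuous_fderiv one_ne_zero).clm_apply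
      continuous_const).integrable_of_hasCompactSupport (hXc.fderiv_apply ℝ v)
  have hzero (v : EuclideanSpace ℝ (Fin n)) : ∫ x, fderiv ℝ X x v = 0 := by
    have h := integral_smul_fderiv_eq_neg_fderiv_smul_of_integrable (μ := volume)
      (f := fun _ : EuclideanSpace ℝ (Fin n) => (1 : ℝ)) (g := X) (v := v)
      (by simp) (by simpa using hint v)
      (by simpa using hX.continuous.integrable_of_hasCompactSupport hXc)
      (fun x _ => differentiableAt_const 1) (fun x _ => hX.differentiable one_ne_zero x)
    simpa using h
  simp only [ediv_eq_sum_inner]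
  rw [integral_finsetSum _ fun i _ => (hint _).const_inner _]
  refine Finset.sum_eq_zero fun i _ => ?_
  rw [integral_inner (hint _), hzero, inner_zero_right]

theorem ediv_smul {n : ℕ} {u : EuclideanSpace ℝ (Fin n) → ℝ}
    {u' : EuclideanSpace ℝ (Fin n) →L[ℝ] ℝ}
    {X : EuclideanSpace ℝ (Fin n) → EuclideanSpace ℝ (Fin n)} {x : EuclideanSpace ℝ (Fin n)}
    (hu : HasFDerivAt u u' x) (hX : DifferentiableAt ℝ X x) :
    ediv (fun y => u y • X y) x = u x * ediv X x + u' (X x) := by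
  have h : fderiv ℝ (fun y => u y • X y) x = u x • fderiv ℝ X x + u'.smulRight (X x) :=
    (hu.smul hX.hasFDerivAt).fderiv
  have htr := LinearMap.trace_smulRight u'.toLinearMap (X x)
  simp only [ediv, h, ContinuousLinearMap.toLinearMap_add, ContinuousLinearMap.toLinearMap_smul,
    map_add, map_smul, smul_eq_mul]
  exact congrArg _ htr

theorem ContDiffOn.gradient_of_isOpen {E : Type*} [NormedAddCommGroup E] [InnerProductSpace ℝ E]
    [CompleteSpace E] {f : E → ℝ} {s : Set E} {m k : WithTop ℕ∞} (hf : ContDiffOn ℝ k f s)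
    (hs : IsOpen s) (hmk : m + 1 ≤ k) : ContDiffOn ℝ m (gradient f) s :=
  (InnerProductSpace.toDual ℝ E).symm.toContinuousLinearEquiv.contDiff.comp_contDiffOn
    (hf.fderiv_of_isOpen hs hmk)

theorem ContDiffOn.contDiff_of_tsupport_subset {E F : Type*} [NormedAddCommGroup E]
    [NormedSpace ℝ E] [NormedAddCommGroup F] [NormedSpace ℝ F] {g : E → F} {s : Set E}
    {k : WithTop ℕ∞} (hg : ContDiffOn ℝ k g s) (hs : IsOpen s) (hsupp : tsupport g ⊆ s) :
    ContDiff ℝ k g := by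
  refine contDiff_iff_contDiffAt.2 fun x => ?_
  by_cases hx : x ∈ tsupport g
  · exact hg.contDiffAt (hs.mem_nhds (hsupp hx))
  · exact contDiffAt_const.congr_of_eventuallyEq (notMem_tsupport_iff_eventuallyEq.1 hx)

/-- The pointwise inequality `div ((φ² / f) ∇f) ≤ ‖∇φ‖² - c φ²` behind Barta's theorem. -/
theorem ediv_sq_div_smul_gradient_le {n : ℕ} {φ f : EuclideanSpace ℝ (Fin n) → ℝ}
    {x : EuclideanSpace ℝ (Fin n)} {c : ℝ} (hφ : DifferentiableAt ℝ φ x)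
    (hf : DifferentiableAt ℝ f x) (hf' : DifferentiableAt ℝ (gradient f) x) (hpos : 0 < f x)
    (hc : c * f x ≤ -lap f x) :
    ediv (fun y => (φ y ^ 2 * (f y)⁻¹) • gradient f y) x ≤
      ‖gradient φ x‖ ^ 2 - c * φ x ^ 2 := by
  have hu : HasFDerivAt (fun y => φ y ^ 2 * (f y)⁻¹) _ x :=
    (hφ.hasFDerivAt.pow 2).mul ((hasDerivAt_inv hpos.ne').comp_hasFDerivAt x hf.hasFDerivAt)
  have hlap : ediv (gradient f) x = lap f x := rfl
  have hL : φ x ^ 2 * (f x)⁻¹ * lap f x ≤ -(c * φ x ^ 2) := by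
    calc φ x ^ 2 * (f x)⁻¹ * lap f x ≤ φ x ^ 2 * (f x)⁻¹ * (-(c * f x)) := by
          gcongr; linarith
      _ = -(c * φ x ^ 2) := by field_simp
  have hsq := norm_sub_sq_real (gradient φ x) ((φ x * (f x)⁻¹) • gradient f x)
  rw [inner_smul_right, norm_smul, mul_pow, Real.norm_eq_abs, sq_abs] at hsq
  have hnn := sq_nonneg ‖gradient φ x - (φ x * (f x)⁻¹) • gradient f x‖
  rw [ediv_smul hu hf', hlap]
  simp only [add_apply, smul_apply, smul_eq_mul,
    ← inner_gradient_left, real_inner_self_eq_norm_sq]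
  simp only [inv_pow, mul_pow, nsmul_eq_mul] at *
  push_cast
  nlinarith

/-- lower-bound half of Barta's Theorem 2.1, Euclidean case: if `f` is `C²`
and positive on the open set `Ω ⊆ ℝⁿ` with `-Δf ≥ c f` on `Ω`, then `λ*(Ω) ≥ c`. -/
theorem stmt2 (n : ℕ) (hn : 2 ≤ n) (Ω : Set (EuclideanSpace ℝ (Fin n))) (hΩ : IsOpen Ω)
    (f : EuclideanSpace ℝ (Fin n) → ℝ) (hf : ContDiffOn ℝ 2 f Ω)
    (hfpos : ∀ x ∈ Ω, 0 < f x)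
    (c : ℝ) (hc : ∀ x ∈ Ω, c * f x ≤ -lap f x) :
    ENNReal.ofReal c ≤ lamStar n Ω := by
  refine le_iInf fun ⟨φ, hφ, hφc, hφΩ, hφ0⟩ => ENNReal.ofReal_le_ofReal ?_
  have hgradf : ContDiffOn ℝ 1 (gradient f) Ω := hf.gradient_of_isOpen hΩ (by norm_num)
  have hgradφ : Continuous (gradient φ) :=
    (InnerProductSpace.toDual ℝ _).symm.continuous.comp (hφ.continuous_fderiv (by simp))
  have hφout {x} (hx : x ∉ tsupport φ) : φ x = 0 := image_eq_zero_of_notMem_tsupport hx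
  have hgradφout {x} (hx : x ∉ tsupport φ) : gradient φ x = 0 :=
    gradient_eq_zero_of_notMem_tsupport hx
  have hsq : Continuous fun x => φ x ^ 2 := hφ.continuous.pow 2
  have hsqc : HasCompactSupport fun x => φ x ^ 2 :=
    HasCompactSupport.intro hφc fun x hx => by simp [hφout hx]
  have hnorm : Integrable fun x => ‖gradient φ x‖ ^ 2 :=
    (hgradφ.norm.pow 2).integrable_of_hasCompactSupport
      (HasCompactSupport.intro hφc fun x hx => by simp [hgradφout hx])
  have hpos : 0 < ∫ x, φ x ^ 2 := by
    obtain ⟨x, hx⟩ := Function.ne_iff.1 hφ0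
    exact hsq.integral_pos_of_hasCompactSupport_nonneg_nonzero hsqc (fun x => sq_nonneg (φ x))
      (pow_ne_zero 2 hx)
  rw [setIntegral_eq_integral_of_forall_compl_eq_zero fun x hx => by
      simp [hgradφout fun h => hx (hφΩ h)],
    setIntegral_eq_integral_of_forall_compl_eq_zero fun x hx => by
      simp [hφout fun h => hx (hφΩ h)],
    le_div_iff₀ hpos]
  let Y := fun x => (φ x ^ 2 * (f x)⁻¹) • gradient f x
  have hYsupp : tsupport Y ⊆ tsupport φ :=
    closure_mono fun x hx h => hx (by simp [Y, h])
  have hYout {x} (hx : x ∉ tsupport φ) : ediv Y x = 0 :=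
    ediv_eq_zero_of_notMem_tsupport fun h => hx (hYsupp h)
  have hYc : HasCompactSupport Y := hφc.mono' (subset_closure.trans hYsupp)
  have hY : ContDiff ℝ 1 Y := by
    refine ContDiffOn.contDiff_of_tsupport_subset ?_ hΩ (hYsupp.trans hφΩ)
    exact (((hφ.of_le (by simp)).contDiffOn.pow 2).mul
      ((hf.of_le (by norm_num)).inv fun x hx => (hfpos x hx).ne')).smul hgradf
  have hle (x) : ediv Y x ≤ ‖gradient φ x‖ ^ 2 - c * φ x ^ 2 := by
    by_cases hx : x ∈ tsupport φ
    · replace hx := hφΩ hx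
      exact ediv_sq_div_smul_gradient_le (hφ.differentiable (by simp) x)
        ((hf.contDiffAt (hΩ.mem_nhds hx)).differentiableAt (by simp))
        ((hgradf.contDiffAt (hΩ.mem_nhds hx)).differentiableAt (by simp)) (hfpos x hx) (hc x hx)
    · simp [hYout hx, hgradφout hx, hφout hx]
  have hcsq := (hsq.integrable_of_hasCompactSupport (μ := volume) hsqc).const_mul c
  have hmono := integral_mono (hY.continuous_ediv.integrable_of_hasCompactSupport
    (HasCompactSupport.intro hφc fun x hx => hYout hx))
    (hnorm.sub hcsq) hle
  rw [integral_ediv_eq_zero hY hYc] at hmono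
  simp only [Pi.sub_apply] at hmono
  rw [integral_sub hnorm hcsq, integral_const_mul] at hmono
  linarith
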